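/- For every real c with (9−2√2)/73 < c < 1/11, set a = (1 − 7c + √(−73c² + 18c − 1))/2 and b = (1 − 7c − √(−73c² + 18c − 1))/2. Then the 9×9 diagonal matrix diag(a, b, c, c, c, c, c, c, c) is an extreme point of AP_{3,3}. -/

import Mathlib

open Matrix ComplexOrder

noncomputable section

/-- Index type for a two-qutrit system. -/
abbrev QIdx : Type := Fin 3 × Fin 3

/-- Partial transpose: `PT M ((i,j),(k,l)) = M ((i,l),(k,j))`. -/
def PT (M : Matrix QIdx QIdx ℂ) : Matrix QIdx QIdx ℂ :=
  fun p q => M (p.1, q.2) (q.1, p.2)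

/-- The set of absolutely PPT two-qutrit states. -/
def AP33 : Set (Matrix QIdx QIdx ℂ) :=
  {ρ | ρ.PosSemidef ∧ ρ.trace = 1 ∧
    ∀ U : Matrix QIdx QIdx ℂ, U ∈ Matrix.unitaryGroup QIdx ℂ →
      (PT (U * ρ * Uᴴ)).PosSemidef}

/-- The 9×9 diagonal matrix with prescribed real diagonal entries
(listed in order), regarded as a matrix indexed by `QIdx`. -/
def diag9 (d : Fin 9 → ℝ) : Matrix QIdx QIdx ℂ :=
  Matrix.diagonal fun p => ((d ((finProdFinEquiv.trans (finCongr (by norm_num))) p) : ℝ) : ℂ)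

theorem Matrix.exists_unitary_mul_diagonal_mul_unitary {n : Type*} [Fintype n] [DecidableEq n]
    (X : Matrix n n ℂ) :
    ∃ P ∈ Matrix.unitaryGroup n ℂ, ∃ W ∈ Matrix.unitaryGroup n ℂ, ∃ s : n → ℝ,
      (∀ i, 0 ≤ s i) ∧ X = P * diagonal (fun i => (s i : ℂ)) * W := by
  have hX : (X * Xᴴ).PosSemidef := posSemidef_self_mul_conjTranspose X
  set V : Matrix n n ℂ := (hX.1.eigenvectorUnitary : Matrix n n ℂ) with hV
  have hVmem : V ∈ Matrix.unitaryGroup n ℂ := hX.1.eigenvectorUnitary.2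
  set ev := hX.1.eigenvalues with hev
  have hnonneg : ∀ i, 0 ≤ ev i := hX.eigenvalues_nonneg
  set B : Matrix n n ℂ := Vᴴ * X with hB
  have hVV : V * Vᴴ = 1 := Matrix.mem_unitaryGroup_iff.mp hVmem
  have hBB : B * Bᴴ = diagonal (fun i => (ev i : ℂ)) := by
    have h := hX.1.conjStarAlgAut_star_eigenvectorUnitary
    rw [Unitary.conjStarAlgAut_star_apply] at h
    rw [hB, conjTranspose_mul, conjTranspose_conjTranspose]
    calc Vᴴ * X * (Xᴴ * V) = Vᴴ * (X * Xᴴ) * V := by simp only [Matrix.mul_assoc]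
      _ = _ := h
  have hentry : ∀ i k, ∑ j, B i j * star (B k j) = if i = k then (ev i : ℂ) else 0 := by
    intro i k
    have := congrFun (congrFun hBB i) k
    simpa [Matrix.mul_apply, Matrix.diagonal_apply] using this
  let s : n → ℝ := fun i => √(ev i)
  have hss : ∀ i, s i * s i = ev i := fun i => Real.mul_self_sqrt (hnonneg i)
  let v : n → EuclideanSpace ℂ n := fun i => WithLp.toLp 2 fun j => B i j / (s i : ℂ)
  let S : Set n := {i | s i ≠ 0}
  have hv : Orthonormal ℂ (S.domRestrict v) := by
    rw [orthonormal_iff_ite]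
    rintro ⟨i, hi⟩ ⟨k, hk⟩
    have hik := hentry k i
    have hi' : (s i : ℂ) ≠ 0 := by exact_mod_cast hi
    have hk' : (s k : ℂ) ≠ 0 := by exact_mod_cast hk
    have : inner ℂ (S.domRestrict v ⟨i, hi⟩) (S.domRestrict v ⟨k, hk⟩)
        = (∑ j, B k j * star (B i j)) / (s k * s i) := by
      simp [v, PiLp.inner_apply, Finset.sum_div]
      refine Finset.sum_congr rfl fun j _ => ?_
      field_simp
    rw [this, hik]
    by_cases h : i = k
    · subst h
      have : (ev i : ℂ) = s i * s i := by rw [← hss]; push_cast; rfl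
      simp [this, hi']
    · simp [h, Ne.symm h]
  obtain ⟨b, hb⟩ := hv.exists_orthonormalBasis_extension_of_card_eq (by simp)
  let W : Matrix n n ℂ := Matrix.of fun i j => b i j
  have hW : W ∈ Matrix.unitaryGroup n ℂ := by
    rw [Matrix.mem_unitaryGroup_iff]
    ext i k
    have := orthonormal_iff_ite.mp b.orthonormal k i
    rw [PiLp.inner_apply] at this
    simp only [RCLike.inner_apply] at this
    simpa [W, Matrix.mul_apply, Matrix.star_apply, Matrix.one_apply, eq_comm] using this
  refine ⟨V, hVmem, W, hW, s, fun i => Real.sqrt_nonneg _, ?_⟩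
  have hBW : B = diagonal (fun i => (s i : ℂ)) * W := by
    ext i j
    rw [diagonal_mul]
    by_cases hi : s i = 0
    · have h0 := hentry i i
      rw [if_pos rfl, ← hss, hi] at h0
      simp only [mul_zero, Complex.ofReal_zero] at h0
      have h1 : ∑ j, ‖B i j‖ ^ 2 = 0 := by
        have : ((∑ j, ‖B i j‖ ^ 2 : ℝ) : ℂ) = 0 := by
          rw [← h0]; push_cast
          exact Finset.sum_congr rfl fun j _ => (Complex.mul_conj' _).symm
        exact_mod_cast this
      have h2 := (Finset.sum_eq_zero_iff_of_nonneg (fun j _ => by positivity)).mp h1 j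
        (Finset.mem_univ j)
      simp [hi, norm_eq_zero.mp (pow_eq_zero_iff (two_ne_zero) |>.mp h2)]
    · have hi' : (s i : ℂ) ≠ 0 := by exact_mod_cast hi
      simp only [W, Matrix.of_apply, hb i hi, v]
      field_simp
  rw [Matrix.mul_assoc, ← hBW, hB, ← Matrix.mul_assoc, hVV, Matrix.one_mul]

theorem mul_add_mul_le_of_sq_add_sq {α β c x y z : ℝ} (hc : 0 ≤ c) (hx : 0 ≤ x)
    (h : α ^ 2 + β ^ 2 = 4 * c ^ 2) :
    α * (x * y) + β * (x * z) ≤ c * (x ^ 2 + y ^ 2 + z ^ 2) := by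
  set R := √(y ^ 2 + z ^ 2) with hR
  have hR0 : 0 ≤ R := Real.sqrt_nonneg _
  have hR2 : R ^ 2 = y ^ 2 + z ^ 2 := Real.sq_sqrt (by positivity)
  have h1 : α * y + β * z ≤ 2 * c * R := by
    apply le_of_sq_le_sq _ (by positivity)
    have : (2 * c * R) ^ 2 = (α ^ 2 + β ^ 2) * (y ^ 2 + z ^ 2) := by rw [h, ← hR2]; ring
    rw [this]
    nlinarith [sq_nonneg (α * z - β * y)]
  nlinarith [mul_le_mul_of_nonneg_left h1 hx, mul_nonneg hc (sq_nonneg (x - R))]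

theorem weighted_sum_le_of_pairs_le {α β M t₁ t₂ t₃ p₁ p₂ p₃ r₁ r₂ r₃ : ℝ}
    (hβ : 0 ≤ β) (hαβ : β ≤ α)
    (ht₁ : 0 ≤ t₁) (ht₂ : 0 ≤ t₂) (ht₃ : 0 ≤ t₃)
    (hp₁ : 0 ≤ p₁) (hp₂ : 0 ≤ p₂) (hp₃ : 0 ≤ p₃)
    (hp : p₁ + p₂ + p₃ ≤ 1) (hr : r₁ + r₂ + r₃ ≤ 1)
    (h₁ : p₁ + r₁ ≤ 1) (h₂ : p₂ + r₂ ≤ 1) (h₃ : p₃ + r₃ ≤ 1)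
    (hM : ∀ x ∈ ({(t₁, t₂), (t₁, t₃), (t₂, t₁), (t₂, t₃), (t₃, t₁), (t₃, t₂)} : Set (ℝ × ℝ)),
      α * x.1 + β * x.2 ≤ M) :
    α * (t₁ * p₁ + t₂ * p₂ + t₃ * p₃) + β * (t₁ * r₁ + t₂ * r₂ + t₃ * r₃) ≤ M := by
  simp only [Set.mem_insert_iff, Set.mem_singleton_iff, forall_eq_or_imp, forall_eq] at hM
  obtain ⟨m12, m13, m21, m23, m31, m32⟩ := hM
  have key : ∀ a b d wa wb wd pa pb pd : ℝ, 0 ≤ pa → 0 ≤ pb → 0 ≤ pd → pa + pb + pd ≤ 1 →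
      wa ≤ 1 → wb ≤ 1 → wa + wb + wd ≤ 2 → 0 ≤ d → d ≤ b → b ≤ a →
      α * a + β * b ≤ M →
      (α - β) * (a * pa + b * pb + d * pd) + β * (a * wa + b * wb + d * wd) ≤ M := by
    intro a b d wa wb wd pa pb pd ha hb hd hs hwa hwb hw h0 hdb hba hm
    have e1 : a * pa + b * pb + d * pd ≤ a := by nlinarith
    have e2 : a * wa + b * wb + d * wd ≤ a + b := by
      nlinarith [mul_nonneg (sub_nonneg.2 hwa) (sub_nonneg.2 (hdb.trans hba)),
        mul_nonneg (sub_nonneg.2 hwb) (sub_nonneg.2 hdb)]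
    nlinarith [mul_le_mul_of_nonneg_left e1 (sub_nonneg.2 hαβ), mul_le_mul_of_nonneg_left e2 hβ]
  rcases le_total t₁ t₂ with a | a <;> rcases le_total t₂ t₃ with b | b <;>
    rcases le_total t₁ t₃ with d | d
  · linarith [key t₃ t₂ t₁ (p₃ + r₃) (p₂ + r₂) (p₁ + r₁) p₃ p₂ p₁ hp₃ hp₂ hp₁ (by linarith)
      (by linarith) (by linarith) (by linarith) ht₁ (by linarith) (by linarith) (by linarith)]
  · linarith [key t₃ t₂ t₁ (p₃ + r₃) (p₂ + r₂) (p₁ + r₁) p₃ p₂ p₁ hp₃ hp₂ hp₁ (by linarith)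
      (by linarith) (by linarith) (by linarith) ht₁ (by linarith) (by linarith) (by linarith)]
  · linarith [key t₂ t₃ t₁ (p₂ + r₂) (p₃ + r₃) (p₁ + r₁) p₂ p₃ p₁ hp₂ hp₃ hp₁ (by linarith)
      (by linarith) (by linarith) (by linarith) ht₁ (by linarith) (by linarith) (by linarith)]
  · linarith [key t₂ t₁ t₃ (p₂ + r₂) (p₁ + r₁) (p₃ + r₃) p₂ p₁ p₃ hp₂ hp₁ hp₃ (by linarith)
      (by linarith) (by linarith) (by linarith) ht₃ (by linarith) (by linarith) (by linarith)]
  · linarith [key t₃ t₁ t₂ (p₃ + r₃) (p₁ + r₁) (p₂ + r₂) p₃ p₁ p₂ hp₃ hp₁ hp₂ (by linarith)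
      (by linarith) (by linarith) (by linarith) ht₂ (by linarith) (by linarith) (by linarith)]
  · linarith [key t₁ t₃ t₂ (p₁ + r₁) (p₃ + r₃) (p₂ + r₂) p₁ p₃ p₂ hp₁ hp₃ hp₂ (by linarith)
      (by linarith) (by linarith) (by linarith) ht₂ (by linarith) (by linarith) (by linarith)]
  · linarith [key t₁ t₂ t₃ (p₁ + r₁) (p₂ + r₂) (p₃ + r₃) p₁ p₂ p₃ hp₁ hp₂ hp₃ (by linarith)
      (by linarith) (by linarith) (by linarith) ht₃ (by linarith) (by linarith) (by linarith)]
  · linarith [key t₁ t₂ t₃ (p₁ + r₁) (p₂ + r₂) (p₃ + r₃) p₁ p₂ p₃ hp₁ hp₂ hp₃ (by linarith)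
      (by linarith) (by linarith) (by linarith) ht₃ (by linarith) (by linarith) (by linarith)]

theorem norm_sub_sq_add_norm_sub_sq_le_two {ι : Type*} [Fintype ι] {u v : ι → ℂ}
    (hu : star u ⬝ᵥ u = 1) (hv : star v ⬝ᵥ v = 1) (huv : star u ⬝ᵥ v = 0)
    {p q : ι} (hpq : p ≠ q) :
    ‖u p - u q‖ ^ 2 + ‖v p - v q‖ ^ 2 ≤ 2 := by
  classical
  have hin : ∀ x y : ι → ℂ, inner ℂ (WithLp.toLp 2 x) (WithLp.toLp 2 y) = star x ⬝ᵥ y := by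
    intro x y
    rw [EuclideanSpace.inner_toLp_toLp, dotProduct_comm]
  have huv' : star v ⬝ᵥ u = 0 := by
    rw [star_dotProduct, huv, star_zero]
  have hon : Orthonormal ℂ ![WithLp.toLp 2 u, WithLp.toLp 2 v] := by
    rw [orthonormal_iff_ite]
    intro i j
    fin_cases i <;> fin_cases j
    · exact (hin _ _).trans (by simpa using hu)
    · exact (hin _ _).trans (by simpa using huv)
    · exact (hin _ _).trans (by simpa using huv')
    · exact (hin _ _).trans (by simpa using hv)
  have := hon.sum_inner_products_le (s := Finset.univ)
    (x := WithLp.toLp 2 (Pi.single p 1 - Pi.single q 1 : ι → ℂ))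
  have hn : ‖(WithLp.toLp 2 (Pi.single p 1 - Pi.single q 1 : ι → ℂ) : EuclideanSpace ℂ ι)‖ ^ 2
      = 2 := by
    have h := inner_self_eq_norm_sq_to_K (𝕜 := ℂ)
      (WithLp.toLp 2 (Pi.single p 1 - Pi.single q 1 : ι → ℂ) : EuclideanSpace ℂ ι)
    rw [hin] at h
    have h2 : star (Pi.single p 1 - Pi.single q 1 : ι → ℂ) ⬝ᵥ
        (Pi.single p 1 - Pi.single q 1 : ι → ℂ) = 2 := by
      simp [dotProduct_sub, hpq, hpq.symm]
      norm_num
    rw [h2] at h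
    exact Complex.ofReal_injective (by simpa using h.symm)
  rw [hn, Fin.sum_univ_two] at this
  have hval : ∀ x : ι → ℂ, ‖star x ⬝ᵥ (Pi.single p 1 - Pi.single q 1 : ι → ℂ)‖ = ‖x p - x q‖ := by
    intro x
    rw [← norm_star (x p - x q)]
    simp [dotProduct_sub]
  simpa only [Matrix.cons_val_zero, Matrix.cons_val_one, hin, hval] using this

theorem neg_weighted_antisymm_le_swap_form {s : Fin 3 → ℝ} (hs : ∀ i, 0 ≤ s i) (u : QIdx → ℂ) :
    -(s 0 * s 1 * (‖u (0, 1) - u (1, 0)‖ ^ 2 / 2) + s 0 * s 2 * (‖u (0, 2) - u (2, 0)‖ ^ 2 / 2)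
        + s 1 * s 2 * (‖u (1, 2) - u (2, 1)‖ ^ 2 / 2))
      ≤ (∑ i, ∑ k, (s i : ℂ) * u (k, i) * star ((s k : ℂ) * u (i, k))).re := by
  have h01 := mul_nonneg (mul_nonneg (hs 0) (hs 1)) (sq_nonneg ‖u (0, 1) + u (1, 0)‖)
  have h02 := mul_nonneg (mul_nonneg (hs 0) (hs 2)) (sq_nonneg ‖u (0, 2) + u (2, 0)‖)
  have h12 := mul_nonneg (mul_nonneg (hs 1) (hs 2)) (sq_nonneg ‖u (1, 2) + u (2, 1)‖)
  have h0 := mul_nonneg (mul_nonneg (hs 0) (hs 0)) (sq_nonneg ‖u (0, 0)‖)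
  have h1 := mul_nonneg (mul_nonneg (hs 1) (hs 1)) (sq_nonneg ‖u (1, 1)‖)
  have h2 := mul_nonneg (mul_nonneg (hs 2) (hs 2)) (sq_nonneg ‖u (2, 2)‖)
  simp only [Complex.sq_norm, Complex.normSq_apply, Complex.add_re, Complex.add_im,
    Complex.sub_re, Complex.sub_im] at *
  simp only [Fin.sum_univ_three, Complex.add_re, Complex.mul_re, Complex.mul_im, star_mul',
    RCLike.star_def, Complex.conj_re, Complex.conj_im, Complex.ofReal_re, Complex.ofReal_im,
    Complex.conj_ofReal]
  linarith

theorem antisymm_weight_le_one {u : QIdx → ℂ} (hu : star u ⬝ᵥ u = 1) :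
    ‖u (0, 1) - u (1, 0)‖ ^ 2 / 2 + ‖u (0, 2) - u (2, 0)‖ ^ 2 / 2
      + ‖u (1, 2) - u (2, 1)‖ ^ 2 / 2 ≤ 1 := by
  have h := congrArg Complex.re hu
  simp only [dotProduct, Fintype.sum_prod_type, Fin.sum_univ_three, Pi.star_apply, RCLike.star_def,
    Complex.add_re, Complex.mul_re, Complex.conj_re, Complex.conj_im, Complex.one_re] at h
  simp only [Complex.sq_norm, Complex.normSq_apply, Complex.sub_re, Complex.sub_im]
  nlinarith [sq_nonneg ((u (0, 1)).re + (u (1, 0)).re), sq_nonneg ((u (0, 1)).im + (u (1, 0)).im),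
    sq_nonneg ((u (0, 2)).re + (u (2, 0)).re), sq_nonneg ((u (0, 2)).im + (u (2, 0)).im),
    sq_nonneg ((u (1, 2)).re + (u (2, 1)).re), sq_nonneg ((u (1, 2)).im + (u (2, 1)).im),
    sq_nonneg (u (0, 0)).re, sq_nonneg (u (0, 0)).im, sq_nonneg (u (1, 1)).re,
    sq_nonneg (u (1, 1)).im, sq_nonneg (u (2, 2)).re, sq_nonneg (u (2, 2)).im]

theorem weighted_swap_form_nonneg_of_diagonal {α β c : ℝ} (hβ : 0 ≤ β) (hαβ : β ≤ α) (hc : 0 ≤ c)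
    (h : α ^ 2 + β ^ 2 = 4 * c ^ 2) {s : Fin 3 → ℝ} (hs : ∀ i, 0 ≤ s i) {u v : QIdx → ℂ}
    (hu : star u ⬝ᵥ u = 1) (hv : star v ⬝ᵥ v = 1) (huv : star u ⬝ᵥ v = 0) :
    0 ≤ α * (∑ i, ∑ k, (s i : ℂ) * u (k, i) * star ((s k : ℂ) * u (i, k))).re
      + β * (∑ i, ∑ k, (s i : ℂ) * v (k, i) * star ((s k : ℂ) * v (i, k))).re
      + c * ∑ i, s i ^ 2 := by
  have hα : 0 ≤ α := hβ.trans hαβ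
  have e1 := mul_le_mul_of_nonneg_left (neg_weighted_antisymm_le_swap_form hs u) hα
  have e2 := mul_le_mul_of_nonneg_left (neg_weighted_antisymm_le_swap_form hs v) hβ
  have B := fun {p q : QIdx} (hpq : p ≠ q) => norm_sub_sq_add_norm_sub_sq_le_two hu hv huv hpq
  have b01 := B (p := (0, 1)) (q := (1, 0)) (by decide)
  have b02 := B (p := (0, 2)) (q := (2, 0)) (by decide)
  have b12 := B (p := (1, 2)) (q := (2, 1)) (by decide)
  have e3 := weighted_sum_le_of_pairs_le (M := c * (s 0 ^ 2 + s 1 ^ 2 + s 2 ^ 2)) hβ hαβ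
    (mul_nonneg (hs 0) (hs 1)) (mul_nonneg (hs 0) (hs 2)) (mul_nonneg (hs 1) (hs 2))
    (by positivity) (by positivity) (by positivity)
    (antisymm_weight_le_one hu) (antisymm_weight_le_one hv)
    (by linarith) (by linarith) (by linarith) (by
      simp only [Set.mem_insert_iff, Set.mem_singleton_iff, forall_eq_or_imp, forall_eq]
      have m := fun i j k => mul_add_mul_le_of_sq_add_sq (y := s j) (z := s k) hc (hs i) h
      refine ⟨?_, ?_, ?_, ?_, ?_, ?_⟩
      · linarith [m 0 1 2]
      · linarith [m 1 0 2]
      · linarith [m 0 2 1]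
      · linarith [m 2 0 1]
      · linarith [m 1 2 0]
      · linarith [m 2 1 0])
  rw [Fin.sum_univ_three (fun i => s i ^ 2)]
  linarith

theorem trace_conjTranspose_mul_eq_dotProduct (A B : Matrix (Fin 3) (Fin 3) ℂ) :
    (Aᴴ * B).trace = star (fun p : QIdx => A p.1 p.2) ⬝ᵥ (fun p : QIdx => B p.1 p.2) := by
  simp only [trace, diag, mul_apply, conjTranspose_apply, dotProduct, Fintype.sum_prod_type,
    Pi.star_apply]
  exact Finset.sum_comm

theorem trace_swap_form_of_svd {P W D X u : Matrix (Fin 3) (Fin 3) ℂ}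
    (hP : P ∈ unitaryGroup (Fin 3) ℂ) (hX : X = P * D * W) :
    ((X * uᵀ) * (X * uᵀ).map (starRingEnd ℂ)).trace =
      ((D * (Pᴴ * u * Wᵀ)ᵀ) * (D * (Pᴴ * u * Wᵀ)ᵀ).map (starRingEnd ℂ)).trace := by
  have h1 : P * Pᴴ = 1 := Matrix.mem_unitaryGroup_iff.mp hP
  have h2 : Pᴴ * P = 1 := Matrix.mem_unitaryGroup_iff'.mp hP
  have h3 : Pᴴᵀ * Pᵀ = 1 := by rw [← transpose_mul, h1, transpose_one]
  have h4 : Pᵀ * Pᴴᵀ = 1 := by rw [← transpose_mul, h2, transpose_one]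
  have hPc : P.map (starRingEnd ℂ) = Pᴴᵀ := rfl
  have hPt : (Pᵀ).map (starRingEnd ℂ) = Pᴴ := rfl
  set G := D * (Pᴴ * u * Wᵀ)ᵀ with hG
  have hXG : X * uᵀ = P * G * Pᵀ := by
    rw [hX, hG]
    simp only [transpose_mul, transpose_transpose, Matrix.mul_assoc, h3, Matrix.mul_one]
  rw [hXG, Matrix.map_mul, Matrix.map_mul, hPc, hPt]
  calc (P * G * Pᵀ * (Pᴴᵀ * G.map (starRingEnd ℂ) * Pᴴ)).trace
      = (P * (G * (Pᵀ * Pᴴᵀ) * G.map (starRingEnd ℂ) * Pᴴ)).trace := by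
        simp only [Matrix.mul_assoc]
    _ = (G * G.map (starRingEnd ℂ) * (Pᴴ * P)).trace := by
        rw [h4, Matrix.mul_one, Matrix.trace_mul_comm, Matrix.mul_assoc]
    _ = _ := by rw [h2, Matrix.mul_one]

theorem dotProduct_of_unitary_mul_mul {P W u v : Matrix (Fin 3) (Fin 3) ℂ}
    (hP : P ∈ unitaryGroup (Fin 3) ℂ) (hW : W ∈ unitaryGroup (Fin 3) ℂ) :
    star (fun p : QIdx => (Pᴴ * u * Wᵀ) p.1 p.2) ⬝ᵥ (fun p : QIdx => (Pᴴ * v * Wᵀ) p.1 p.2) =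
      star (fun p : QIdx => u p.1 p.2) ⬝ᵥ (fun p : QIdx => v p.1 p.2) := by
  have h1 : P * Pᴴ = 1 := Matrix.mem_unitaryGroup_iff.mp hP
  have h2 : Wᴴ * W = 1 := Matrix.mem_unitaryGroup_iff'.mp hW
  have h3 : Wᵀ * Wᵀᴴ = 1 := by
    change Wᵀ * Wᴴᵀ = 1
    rw [← transpose_mul, h2, transpose_one]
  rw [← trace_conjTranspose_mul_eq_dotProduct, ← trace_conjTranspose_mul_eq_dotProduct]
  simp only [conjTranspose_mul, conjTranspose_conjTranspose]
  calc (Wᵀᴴ * (uᴴ * P) * (Pᴴ * v * Wᵀ)).trace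
      = (Wᵀᴴ * (uᴴ * (P * Pᴴ) * v * Wᵀ)).trace := by simp only [Matrix.mul_assoc]
    _ = (uᴴ * v * (Wᵀ * Wᵀᴴ)).trace := by
        rw [h1, Matrix.mul_one, Matrix.trace_mul_comm, Matrix.mul_assoc]
    _ = _ := by rw [h3, Matrix.mul_one]

theorem weighted_swap_form_nonneg {α β c : ℝ} (hβ : 0 ≤ β) (hαβ : β ≤ α) (hc : 0 ≤ c)
    (h : α ^ 2 + β ^ 2 = 4 * c ^ 2) (X u v : Matrix (Fin 3) (Fin 3) ℂ)
    (hu : star (fun p : QIdx => u p.1 p.2) ⬝ᵥ (fun p : QIdx => u p.1 p.2) = 1)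
    (hv : star (fun p : QIdx => v p.1 p.2) ⬝ᵥ (fun p : QIdx => v p.1 p.2) = 1)
    (huv : star (fun p : QIdx => u p.1 p.2) ⬝ᵥ (fun p : QIdx => v p.1 p.2) = 0) :
    0 ≤ α * ((X * uᵀ) * (X * uᵀ).map (starRingEnd ℂ)).trace.re
      + β * ((X * vᵀ) * (X * vᵀ).map (starRingEnd ℂ)).trace.re
      + c * (Xᴴ * X).trace.re := by
  obtain ⟨P, hP, W, hW, s, hs, hX⟩ := X.exists_unitary_mul_diagonal_mul_unitary
  have h2 : Pᴴ * P = 1 := Matrix.mem_unitaryGroup_iff'.mp hP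
  have h3 : W * Wᴴ = 1 := Matrix.mem_unitaryGroup_iff.mp hW
  have key := weighted_swap_form_nonneg_of_diagonal hβ hαβ hc h hs
    ((dotProduct_of_unitary_mul_mul hP hW).trans hu)
    ((dotProduct_of_unitary_mul_mul hP hW).trans hv)
    ((dotProduct_of_unitary_mul_mul hP hW).trans huv)
  have hT : (Xᴴ * X).trace.re = ∑ i, s i ^ 2 := by
    set D : Matrix (Fin 3) (Fin 3) ℂ := diagonal fun i => (s i : ℂ) with hD
    have : (Xᴴ * X).trace = (Dᴴ * D).trace := by
      rw [hX]
      simp only [conjTranspose_mul]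
      calc (Wᴴ * (Dᴴ * Pᴴ) * (P * D * W)).trace
          = (Wᴴ * (Dᴴ * (Pᴴ * P) * D * W)).trace := by simp only [Matrix.mul_assoc]
        _ = (Dᴴ * D * (W * Wᴴ)).trace := by
          rw [h2, Matrix.mul_one, Matrix.trace_mul_comm, Matrix.mul_assoc]
        _ = _ := by rw [h3, Matrix.mul_one]
    rw [this, hD, diagonal_conjTranspose, diagonal_mul_diagonal, trace_diagonal]
    simp [sq]
  rw [trace_swap_form_of_svd hP hX, trace_swap_form_of_svd hP hX, hT]
  simpa only [trace, diag, mul_apply (M := diagonal _ * _), diagonal_mul, map_apply,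
    transpose_apply, RCLike.star_def] using key

/-- The diagonal matrix with entry `a` at `(0, 0)`, `b` at `(0, 1)` and `c` elsewhere. -/
def twoOneDiag (a b c : ℝ) : Matrix QIdx QIdx ℂ :=
  Matrix.diagonal fun p => ((if p = (0, 0) then a else if p = (0, 1) then b else c : ℝ) : ℂ)

theorem diag9_eq_twoOneDiag (a b c : ℝ) :
    diag9 ![a, b, c, c, c, c, c, c, c] = twoOneDiag a b c := by
  unfold diag9 twoOneDiag
  congr 1
  ext ⟨i, j⟩
  congr 1
  fin_cases i <;> fin_cases j <;> rfl

theorem twoOneDiag_posSemidef {a b c : ℝ} (ha : 0 ≤ a) (hb : 0 ≤ b) (hc : 0 ≤ c) :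
    (twoOneDiag a b c).PosSemidef := by
  refine Matrix.PosSemidef.diagonal fun p => ?_
  simp only [Pi.zero_apply]
  split_ifs <;> exact_mod_cast ‹_›

theorem trace_twoOneDiag (a b c : ℝ) :
    (twoOneDiag a b c).trace = ((a + b + 7 * c : ℝ) : ℂ) := by
  simp [twoOneDiag, trace_diagonal, Fintype.sum_prod_type, Fin.sum_univ_three]
  ring

theorem PT_isHermitian {M : Matrix QIdx QIdx ℂ} (hM : M.IsHermitian) : (PT M).IsHermitian :=
  Matrix.IsHermitian.ext fun p q => hM.apply (p.1, q.2) (q.1, p.2)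

theorem PT_add (M N : Matrix QIdx QIdx ℂ) : PT (M + N) = PT M + PT N := rfl

theorem PT_smul (r : ℝ) (M : Matrix QIdx QIdx ℂ) : PT (r • M) = r • PT M := rfl

theorem PT_one : PT 1 = 1 := by
  ext ⟨i, j⟩ ⟨k, l⟩
  simp only [PT, Matrix.one_apply, Prod.mk.injEq]
  congr 1
  exact propext ⟨fun h => ⟨h.1, h.2.symm⟩, fun h => ⟨h.1, h.2.symm⟩⟩

theorem conj_twoOneDiag {U : Matrix QIdx QIdx ℂ} (hU : U ∈ unitaryGroup QIdx ℂ) (a b c : ℝ) :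
    U * twoOneDiag a b c * Uᴴ =
      c • (1 : Matrix QIdx QIdx ℂ)
        + (a - c) • vecMulVec (fun p => U p (0, 0)) (star fun p => U p (0, 0))
        + (b - c) • vecMulVec (fun p => U p (0, 1)) (star fun p => U p (0, 1)) := by
  have h : twoOneDiag a b c = c • (1 : Matrix QIdx QIdx ℂ)
      + (a - c) • Matrix.single (0, 0) (0, 0) 1 + (b - c) • Matrix.single (0, 1) (0, 1) 1 := by
    ext p q
    by_cases hpq : p = q
    · subst hpq
      by_cases h0 : p = (0, 0)
      · subst h0; simp [twoOneDiag]
      · by_cases h1 : p = (0, 1)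
        · subst h1; simp [twoOneDiag]
        · simp [twoOneDiag, h0, h1, Ne.symm h0, Ne.symm h1]
    · have h2 : ∀ x : QIdx, ¬(x = p ∧ x = q) := fun x hx => hpq (hx.1.symm.trans hx.2)
      simp [twoOneDiag, hpq, h2]
  have hs : ∀ x : QIdx, U * Matrix.single x x 1 * Uᴴ =
      vecMulVec (fun p => U p x) (star fun p => U p x) := by
    intro x
    ext p q
    simp [Matrix.mul_apply, Matrix.single_apply, vecMulVec_apply, ite_and]
  have hUU : U * Uᴴ = 1 := Matrix.mem_unitaryGroup_iff.mp hU
  rw [h, Matrix.mul_add, Matrix.mul_add, Matrix.add_mul, Matrix.add_mul]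
  simp only [Matrix.mul_smul, Matrix.smul_mul, hs, Matrix.mul_one, hUU]

theorem dotProduct_PT_vecMulVec (x u : QIdx → ℂ) :
    star x ⬝ᵥ (PT (vecMulVec u (star u)) *ᵥ x) =
      ((Matrix.of (fun i j => x (i, j)) * (Matrix.of fun i j => u (i, j))ᵀ) *
        (Matrix.of (fun i j => x (i, j)) * (Matrix.of fun i j => u (i, j))ᵀ).map
          (starRingEnd ℂ)).trace := by
  simp only [dotProduct, mulVec, PT, vecMulVec_apply, Fintype.sum_prod_type, Pi.star_apply,
    trace, diag, mul_apply, transpose_apply, of_apply, map_apply, map_add, map_mul,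
    RCLike.star_def, Fin.sum_univ_three]
  ring

theorem twoOneDiag_mem_AP33 {a b c : ℝ} (hc : 0 ≤ c) (hcb : c ≤ b) (hba : b ≤ a)
    (htr : a + b + 7 * c = 1) (h : (a - c) ^ 2 + (b - c) ^ 2 = 4 * c ^ 2) :
    twoOneDiag a b c ∈ AP33 := by
  have hps : (twoOneDiag a b c).PosSemidef :=
    twoOneDiag_posSemidef (hc.trans (hcb.trans hba)) (hc.trans hcb) hc
  refine ⟨hps, by rw [trace_twoOneDiag, htr]; simp, fun U hU => ?_⟩
  have hH := PT_isHermitian (hps.mul_mul_conjTranspose_same U).1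
  refine PosSemidef.of_dotProduct_mulVec_nonneg hH fun x => ?_
  rw [Complex.nonneg_iff]
  refine ⟨?_, (hH.im_star_dotProduct_mulVec_self x).symm⟩
  have horth : ∀ p q, star (fun r => U r p) ⬝ᵥ (fun r => U r q) = if p = q then 1 else 0 := by
    intro p q
    have := congrFun (congrFun (Matrix.mem_unitaryGroup_iff'.mp hU) p) q
    simpa [Matrix.mul_apply, Matrix.one_apply, dotProduct, Matrix.star_apply] using this
  have key := weighted_swap_form_nonneg (sub_nonneg.2 hcb) (sub_le_sub_right hba c) hc h
    (Matrix.of fun i j => x (i, j)) (Matrix.of fun i j => U (i, j) (0, 0))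
    (Matrix.of fun i j => U (i, j) (0, 1)) (horth _ _) (horth _ _) (horth _ _)
  have hx : star x ⬝ᵥ x = (((Matrix.of fun i j => x (i, j)) : Matrix (Fin 3) (Fin 3) ℂ)ᴴ *
      Matrix.of fun i j => x (i, j)).trace :=
    (trace_conjTranspose_mul_eq_dotProduct (Matrix.of fun i j => x (i, j))
      (Matrix.of fun i j => x (i, j))).symm
  rw [conj_twoOneDiag hU, PT_add, PT_add, PT_smul, PT_smul, PT_smul, PT_one]
  simp only [add_mulVec, smul_mulVec, one_mulVec, dotProduct_add, dotProduct_smul,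
    dotProduct_PT_vecMulVec, hx, Complex.add_re, Complex.smul_re, smul_eq_mul]
  linarith

theorem conj_mem_AP33 {σ W : Matrix QIdx QIdx ℂ} (hσ : σ ∈ AP33)
    (hW : W ∈ unitaryGroup QIdx ℂ) : W * σ * Wᴴ ∈ AP33 := by
  obtain ⟨h1, h2, h3⟩ := hσ
  have hWW : Wᴴ * W = 1 := Matrix.mem_unitaryGroup_iff'.mp hW
  refine ⟨h1.mul_mul_conjTranspose_same W, ?_, fun U hU => ?_⟩
  · rw [Matrix.trace_mul_comm, ← Matrix.mul_assoc, hWW, Matrix.one_mul, h2]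
  · have := h3 (U * W) (mul_mem hU hW)
    rwa [conjTranspose_mul, show U * W * σ * (Wᴴ * Uᴴ) = U * (W * σ * Wᴴ) * Uᴴ by
      simp only [Matrix.mul_assoc]] at this

/-- `σ` is an endpoint of a segment in `AP33` having `ρ` in its relative interior. -/
def IsSegmentEnd (ρ σ : Matrix QIdx QIdx ℂ) : Prop :=
  σ ∈ AP33 ∧ ∃ τ ∈ AP33, ρ ∈ openSegment ℝ σ τ

theorem IsSegmentEnd.conj {ρ σ W : Matrix QIdx QIdx ℂ} (h : IsSegmentEnd ρ σ)
    (hW : W ∈ unitaryGroup QIdx ℂ) (hρ : W * ρ * Wᴴ = ρ) : IsSegmentEnd ρ (W * σ * Wᴴ) := by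
  obtain ⟨hσ, τ, hτ, s, t, hs, ht, hst, hsum⟩ := h
  refine ⟨conj_mem_AP33 hσ hW, W * τ * Wᴴ, conj_mem_AP33 hτ hW, s, t, hs, ht, hst, ?_⟩
  rw [← hρ, ← hsum]
  simp only [Matrix.mul_add, Matrix.add_mul, Matrix.mul_smul, Matrix.smul_mul]

theorem IsSegmentEnd.PT_mulVec_eq_zero {ρ σ U : Matrix QIdx QIdx ℂ} (h : IsSegmentEnd ρ σ)
    (hU : U ∈ unitaryGroup QIdx ℂ) {x : QIdx → ℂ}
    (hx : star x ⬝ᵥ (PT (U * ρ * Uᴴ) *ᵥ x) = 0) : PT (U * σ * Uᴴ) *ᵥ x = 0 := by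
  obtain ⟨hσ, τ, hτ, s, t, hs, ht, hst, hsum⟩ := h
  have pσ := hσ.2.2 U hU
  have pτ := hτ.2.2 U hU
  rw [← pσ.dotProduct_mulVec_zero_iff]
  have nσ := pσ.dotProduct_mulVec_nonneg x
  have nτ := pτ.dotProduct_mulVec_nonneg x
  rw [← hsum] at hx
  simp only [Matrix.mul_add, Matrix.add_mul, Matrix.mul_smul, Matrix.smul_mul, PT_add, PT_smul,
    add_mulVec, smul_mulVec, dotProduct_add, dotProduct_smul] at hx
  have h1 : 0 ≤ s • (star x ⬝ᵥ (PT (U * σ * Uᴴ) *ᵥ x)) := smul_nonneg hs.le nσ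
  have h2 : 0 ≤ t • (star x ⬝ᵥ (PT (U * τ * Uᴴ) *ᵥ x)) := smul_nonneg ht.le nτ
  have h3 := ((add_eq_zero_iff_of_nonneg h1 h2).mp hx).1
  exact (smul_eq_zero.mp h3).resolve_left hs.ne'

theorem IsSegmentEnd.phase {a b c : ℝ} {σ : Matrix QIdx QIdx ℂ}
    (h : IsSegmentEnd (twoOneDiag a b c) σ) {d : QIdx → ℂ} (hd : ∀ p, d p * star (d p) = 1) :
    IsSegmentEnd (twoOneDiag a b c) (Matrix.of fun p q => d p * σ p q * star (d q)) := by
  have hW : diagonal d ∈ unitaryGroup QIdx ℂ := by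
    rw [Matrix.mem_unitaryGroup_iff, star_eq_conjTranspose, diagonal_conjTranspose,
      diagonal_mul_diagonal, ← diagonal_one]
    congr 1
    exact funext hd
  have hρ : diagonal d * twoOneDiag a b c * (diagonal d)ᴴ = twoOneDiag a b c := by
    rw [twoOneDiag, diagonal_conjTranspose, diagonal_mul_diagonal, diagonal_mul_diagonal]
    congr 1
    ext p
    rw [Pi.star_apply, mul_right_comm, hd, one_mul]
  convert h.conj hW hρ using 1
  ext p q
  rw [diagonal_conjTranspose, mul_diagonal, diagonal_mul, of_apply, Pi.star_apply]

theorem IsSegmentEnd.perm {a b c : ℝ} {σ : Matrix QIdx QIdx ℂ}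
    (h : IsSegmentEnd (twoOneDiag a b c) σ) {e : Equiv.Perm QIdx}
    (h0 : e (0, 0) = (0, 0)) (h1 : e (0, 1) = (0, 1)) :
    IsSegmentEnd (twoOneDiag a b c) (σ.submatrix e e) := by
  have hconj : ∀ M : Matrix QIdx QIdx ℂ,
      (1 : Matrix QIdx QIdx ℂ).submatrix e id * M * ((1 : Matrix QIdx QIdx ℂ).submatrix e id)ᴴ =
        M.submatrix e e := by
    intro M
    ext p q
    simp [Matrix.mul_apply, Matrix.one_apply]
  have hW : (1 : Matrix QIdx QIdx ℂ).submatrix e id ∈ unitaryGroup QIdx ℂ := by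
    rw [Matrix.mem_unitaryGroup_iff, star_eq_conjTranspose]
    have := hconj 1
    rw [Matrix.mul_one] at this
    rw [this, submatrix_one_equiv]
  have hρ : (twoOneDiag a b c).submatrix e e = twoOneDiag a b c := by
    rw [twoOneDiag, submatrix_diagonal_equiv]
    congr 1
    ext p
    have h0' : e p = (0, 0) ↔ p = (0, 0) := by rw [← h0, e.apply_eq_iff_eq, h0]
    have h1' : e p = (0, 1) ↔ p = (0, 1) := by rw [← h1, e.apply_eq_iff_eq, h1]
    simp only [Function.comp_apply, h0', h1']
  rw [← hconj]
  exact h.conj hW ((hconj _).trans hρ)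

theorem IsSegmentEnd.swap {a b c : ℝ} {σ : Matrix QIdx QIdx ℂ}
    (h : IsSegmentEnd (twoOneDiag a b c) σ) {p q : QIdx}
    (hp0 : p ≠ (0, 0)) (hp1 : p ≠ (0, 1)) (hq0 : q ≠ (0, 0)) (hq1 : q ≠ (0, 1)) :
    IsSegmentEnd (twoOneDiag a b c) (σ.submatrix (Equiv.swap p q) (Equiv.swap p q)) :=
  h.perm (Equiv.swap_apply_of_ne_of_ne hp0.symm hq0.symm)
    (Equiv.swap_apply_of_ne_of_ne hp1.symm hq1.symm)

/-- The vector in `ℂ³ ⊗ ℂ³` with Schmidt coefficients `s` in the standard basis. -/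
def schmidtVec (s : Fin 3 → ℝ) : QIdx → ℂ := fun p => if p.1 = p.2 then (s p.1 : ℂ) else 0

theorem PT_mulVec_schmidtVec (M : Matrix QIdx QIdx ℂ) (s : Fin 3 → ℝ) (p : QIdx) :
    (PT M *ᵥ schmidtVec s) p = ∑ k, (s k : ℂ) * M (p.1, k) (k, p.2) := by
  simp only [mulVec, dotProduct, PT, schmidtVec, Fintype.sum_prod_type]
  refine Finset.sum_congr rfl fun k _ => ?_
  simp [mul_comm]

theorem dotProduct_PT_mulVec_schmidtVec (M : Matrix QIdx QIdx ℂ) (s : Fin 3 → ℝ) :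
    star (schmidtVec s) ⬝ᵥ (PT M *ᵥ schmidtVec s) =
      ∑ i, ∑ k, (s i : ℂ) * ((s k : ℂ) * M (i, k) (k, i)) := by
  simp only [dotProduct, PT_mulVec_schmidtVec, Fintype.sum_prod_type, Pi.star_apply, schmidtVec,
    ← Finset.mul_sum]
  refine Finset.sum_congr rfl fun k _ => ?_
  simp [apply_ite, ite_mul]

/-- Rows of `bellUnitary`. The first two basis vectors become `(f₀₁ - f₁₀) / √2` and
`(f₀₂ - f₂₀) / √2` in the new basis `f`. -/
def bellRow : Fin 3 → Fin 3 → QIdx → ℂ :=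
  let r : ℂ := ((√2)⁻¹ : ℝ)
  ![![Pi.single (0, 2) 1, r • (Pi.single (1, 0) 1 + Pi.single (0, 0) 1),
      r • (Pi.single (1, 1) 1 + Pi.single (0, 1) 1)],
    ![r • (Pi.single (1, 0) 1 - Pi.single (0, 0) 1), Pi.single (1, 2) 1, Pi.single (2, 1) 1],
    ![r • (Pi.single (1, 1) 1 - Pi.single (0, 1) 1), Pi.single (2, 2) 1, Pi.single (2, 0) 1]]

/-- A unitary under whose conjugation the partial transpose becomes singular. -/
def bellUnitary : Matrix QIdx QIdx ℂ := Matrix.of fun p => bellRow p.1 p.2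

theorem bellUnitary_conj_apply (σ : Matrix QIdx QIdx ℂ) (p q : QIdx) :
    (bellUnitary * σ * bellUnitaryᴴ) p q =
      bellRow p.1 p.2 ⬝ᵥ (σ *ᵥ star (bellRow q.1 q.2)) := by
  rw [Matrix.mul_assoc, Matrix.mul_apply]
  rfl

theorem inv_sqrt_two_mul_self : (((√2)⁻¹ : ℝ) : ℂ) * (((√2)⁻¹ : ℝ) : ℂ) = 1 / 2 := by
  rw [← Complex.ofReal_mul, ← mul_inv, Real.mul_self_sqrt (by norm_num)]
  norm_num

theorem bellUnitary_mem : bellUnitary ∈ unitaryGroup QIdx ℂ := by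
  rw [Matrix.mem_unitaryGroup_iff, star_eq_conjTranspose]
  ext ⟨i, j⟩ ⟨k, l⟩
  have h := bellUnitary_conj_apply 1 (i, j) (k, l)
  rw [Matrix.mul_one, Matrix.one_mulVec] at h
  rw [h]
  have hr := inv_sqrt_two_mul_self
  unfold bellRow
  generalize (((√2)⁻¹ : ℝ)) = r at hr ⊢
  fin_cases i <;> fin_cases j <;> fin_cases k <;> fin_cases l <;>
    simp [dotProduct_add, dotProduct_sub, -mul_eq_zero] <;> first | done | linear_combination 2 * hr

theorem dotProduct_PT_bellUnitary_conj_twoOneDiag (a b c : ℝ) (s : Fin 3 → ℝ) :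
    star (schmidtVec s) ⬝ᵥ (PT (bellUnitary * twoOneDiag a b c * bellUnitaryᴴ) *ᵥ schmidtVec s) =
      ((c * (s 0 ^ 2 + s 1 ^ 2 + s 2 ^ 2) - s 0 * s 1 * (a - c) - s 0 * s 2 * (b - c) : ℝ) : ℂ) := by
  have hr := inv_sqrt_two_mul_self
  rw [dotProduct_PT_mulVec_schmidtVec]
  simp only [bellUnitary_conj_apply, Fin.sum_univ_three]
  unfold bellRow
  generalize (((√2)⁻¹ : ℝ)) = r at hr ⊢
  simp [twoOneDiag, mulVec_add, mulVec_sub, mulVec_smul, dotProduct_add, dotProduct_sub]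
  linear_combination (2 * (s 0 : ℂ) * s 1 * (c - a) + 2 * s 0 * s 2 * (c - b)) * hr

theorem IsSegmentEnd.PT_bellUnitary_mulVec_eq_zero {a b c : ℝ} {σ : Matrix QIdx QIdx ℂ}
    (hab : (a - c) ^ 2 + (b - c) ^ 2 = 4 * c ^ 2) (h : IsSegmentEnd (twoOneDiag a b c) σ) :
    PT (bellUnitary * σ * bellUnitaryᴴ) *ᵥ schmidtVec ![2 * c, a - c, b - c] = 0 := by
  refine h.PT_mulVec_eq_zero bellUnitary_mem ?_
  rw [dotProduct_PT_bellUnitary_conj_twoOneDiag]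
  norm_cast
  simp only [Matrix.cons_val]
  linear_combination (-c) * hab

theorem IsSegmentEnd.diagonal_eq {a b c : ℝ} {σ : Matrix QIdx QIdx ℂ}
    (hab : (a - c) ^ 2 + (b - c) ^ 2 = 4 * c ^ 2) (h : IsSegmentEnd (twoOneDiag a b c) σ) :
    4 * c * σ (0, 2) (0, 2)
      + (a - c) * (σ (1, 0) (1, 0) - σ (1, 0) (0, 0) + σ (0, 0) (1, 0) - σ (0, 0) (0, 0))
      + (b - c) * (σ (1, 1) (1, 1) - σ (1, 1) (0, 1) + σ (0, 1) (1, 1) - σ (0, 1) (0, 1)) = 0 := by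
  have hr := inv_sqrt_two_mul_self
  have e := congrFun (h.PT_bellUnitary_mulVec_eq_zero hab) (0, 0)
  rw [PT_mulVec_schmidtVec] at e
  simp only [bellUnitary_conj_apply, Fin.sum_univ_three] at e
  unfold bellRow at e
  generalize (((√2)⁻¹ : ℝ)) = r at hr e
  simp [mulVec_sub, mulVec_smul, dotProduct_sub] at e
  linear_combination 2 * e - 2 *
    ((a - c) * (σ (1, 0) (1, 0) - σ (1, 0) (0, 0) + σ (0, 0) (1, 0) - σ (0, 0) (0, 0))
      + (b - c) * (σ (1, 1) (1, 1) - σ (1, 1) (0, 1) + σ (0, 1) (1, 1) - σ (0, 1) (0, 1))) * hr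

theorem IsSegmentEnd.offDiagonal_eq {a b c : ℝ} {σ : Matrix QIdx QIdx ℂ}
    (hab : (a - c) ^ 2 + (b - c) ^ 2 = 4 * c ^ 2) (h : IsSegmentEnd (twoOneDiag a b c) σ) :
    2 * c * (σ (0, 2) (1, 0) + σ (0, 2) (0, 0)) + (a - c) * (σ (1, 0) (1, 2) + σ (0, 0) (1, 2))
      + (b - c) * (σ (1, 1) (2, 2) + σ (0, 1) (2, 2)) = 0 := by
  have hr := inv_sqrt_two_mul_self
  have e := congrFun (h.PT_bellUnitary_mulVec_eq_zero hab) (0, 1)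
  rw [PT_mulVec_schmidtVec] at e
  simp only [bellUnitary_conj_apply, Fin.sum_univ_three] at e
  unfold bellRow at e
  generalize (((√2)⁻¹ : ℝ)) = r at hr e
  simp [mulVec_add, mulVec_smul, dotProduct_add, -mul_eq_zero] at e
  linear_combination 2 * r * e - 2 * (2 * c * (σ (0, 2) (1, 0) + σ (0, 2) (0, 0))
    + (a - c) * (σ (1, 0) (1, 2) + σ (0, 0) (1, 2))
    + (b - c) * (σ (1, 1) (2, 2) + σ (0, 1) (2, 2))) * hr

theorem IsSegmentEnd.offDiagonal_eq_of_antisymm {a b c : ℝ} {σ : Matrix QIdx QIdx ℂ}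
    (hab : (a - c) ^ 2 + (b - c) ^ 2 = 4 * c ^ 2) (h : IsSegmentEnd (twoOneDiag a b c) σ) :
    c * (σ (1, 0) (1, 1) + σ (1, 0) (0, 1) - σ (0, 0) (1, 1) - σ (0, 0) (0, 1))
      + (a - c) * σ (1, 2) (2, 1) + (b - c) * σ (2, 1) (2, 0) = 0 := by
  have hr := inv_sqrt_two_mul_self
  have e := congrFun (h.PT_bellUnitary_mulVec_eq_zero hab) (1, 2)
  rw [PT_mulVec_schmidtVec] at e
  simp only [bellUnitary_conj_apply, Fin.sum_univ_three] at e
  unfold bellRow at e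
  generalize (((√2)⁻¹ : ℝ)) = r at hr e
  simp [mulVec_add, mulVec_smul, dotProduct_add] at e
  linear_combination e - 2 * c * (σ (1, 0) (1, 1) + σ (1, 0) (0, 1) - σ (0, 0) (1, 1)
    - σ (0, 0) (0, 1)) * hr

theorem IsSegmentEnd.apply_zero_zero_eq_zero {a b c : ℝ} {σ : Matrix QIdx QIdx ℂ}
    (hab : (a - c) ^ 2 + (b - c) ^ 2 = 4 * c ^ 2) (hac : a ≠ c)
    (h : IsSegmentEnd (twoOneDiag a b c) σ) {p : QIdx} (hp0 : p ≠ (0, 0)) (hp1 : p ≠ (0, 1)) :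
    σ p (0, 0) = 0 ∧ σ (0, 0) p = 0 := by
  have main : ∀ τ, IsSegmentEnd (twoOneDiag a b c) τ →
      τ (1, 0) (0, 0) = 0 ∧ τ (0, 0) (1, 0) = 0 := by
    intro τ hτ
    have hac' : (a : ℂ) - c ≠ 0 := sub_ne_zero.2 (by exact_mod_cast hac)
    have E : ∀ z : ℂ, z * star z = 1 → _ := fun z hz => (hτ.phase
      (d := fun p => if p = (1, 0) then z else 1)
      (by intro p; split_ifs; exacts [hz, by simp])).diagonal_eq hab
    have e1 := E 1 (by simp)
    have e2 := E (-1) (by simp)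
    have e3 := E Complex.I (by simp)
    have e4 := E (-Complex.I) (by simp)
    simp at e1 e2 e3 e4
    have f1 : ((a : ℂ) - c) * (τ (1, 0) (0, 0) - τ (0, 0) (1, 0)) = 0 := by
      linear_combination (e2 - e1) / 2
    have f2 : ((a : ℂ) - c) * (τ (1, 0) (0, 0) + τ (0, 0) (1, 0)) = 0 := by
      linear_combination Complex.I * (e3 - e4) / 2 + ((a : ℂ) - c) *
        (τ (1, 0) (0, 0) + τ (0, 0) (1, 0)) * Complex.I_mul_I
    have g1 := (mul_eq_zero.mp f1).resolve_left hac'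
    have g2 := (mul_eq_zero.mp f2).resolve_left hac'
    constructor
    · linear_combination (g1 + g2) / 2
    · linear_combination (g2 - g1) / 2
  simpa [Equiv.swap_apply_of_ne_of_ne, hp0.symm] using
    main _ (h.swap (p := (1, 0)) (q := p) (by decide) (by decide) hp0 hp1)

theorem IsSegmentEnd.apply_zero_one_eq_zero {a b c : ℝ} {σ : Matrix QIdx QIdx ℂ}
    (hab : (a - c) ^ 2 + (b - c) ^ 2 = 4 * c ^ 2) (hbc : b ≠ c)
    (h : IsSegmentEnd (twoOneDiag a b c) σ) {p : QIdx} (hp0 : p ≠ (0, 0)) (hp1 : p ≠ (0, 1)) :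
    σ p (0, 1) = 0 ∧ σ (0, 1) p = 0 := by
  have main : ∀ τ, IsSegmentEnd (twoOneDiag a b c) τ →
      τ (1, 1) (0, 1) = 0 ∧ τ (0, 1) (1, 1) = 0 := by
    intro τ hτ
    have hbc' : (b : ℂ) - c ≠ 0 := sub_ne_zero.2 (by exact_mod_cast hbc)
    have E : ∀ z : ℂ, z * star z = 1 → _ := fun z hz => (hτ.phase
      (d := fun p => if p = (1, 1) then z else 1)
      (by intro p; split_ifs; exacts [hz, by simp])).diagonal_eq hab
    have e1 := E 1 (by simp)
    have e2 := E (-1) (by simp)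
    have e3 := E Complex.I (by simp)
    have e4 := E (-Complex.I) (by simp)
    simp at e1 e2 e3 e4
    have f1 : ((b : ℂ) - c) * (τ (1, 1) (0, 1) - τ (0, 1) (1, 1)) = 0 := by
      linear_combination (e2 - e1) / 2
    have f2 : ((b : ℂ) - c) * (τ (1, 1) (0, 1) + τ (0, 1) (1, 1)) = 0 := by
      linear_combination Complex.I * (e3 - e4) / 2 + ((b : ℂ) - c) *
        (τ (1, 1) (0, 1) + τ (0, 1) (1, 1)) * Complex.I_mul_I
    have g1 := (mul_eq_zero.mp f1).resolve_left hbc'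
    have g2 := (mul_eq_zero.mp f2).resolve_left hbc'
    constructor
    · linear_combination (g1 + g2) / 2
    · linear_combination (g2 - g1) / 2
  simpa [Equiv.swap_apply_of_ne_of_ne, hp1.symm] using
    main _ (h.swap (p := (1, 1)) (q := p) (by decide) (by decide) hp0 hp1)

theorem IsSegmentEnd.apply_eq_zero_of_ne {a b c : ℝ} {σ : Matrix QIdx QIdx ℂ}
    (hab : (a - c) ^ 2 + (b - c) ^ 2 = 4 * c ^ 2) (hac : a ≠ c) (hc : c ≠ 0)
    (h : IsSegmentEnd (twoOneDiag a b c) σ) {p q : QIdx} (hp0 : p ≠ (0, 0)) (hp1 : p ≠ (0, 1))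
    (hq0 : q ≠ (0, 0)) (hq1 : q ≠ (0, 1)) (hpq : p ≠ q) :
    σ p q = 0 := by
  have main : ∀ τ, IsSegmentEnd (twoOneDiag a b c) τ → τ (0, 2) (1, 0) = 0 := by
    intro τ hτ
    have hc' : (c : ℂ) ≠ 0 := by exact_mod_cast hc
    have e1 := hτ.offDiagonal_eq hab
    have e2 := (hτ.phase (d := fun p => if p = (0, 2) then -1 else 1)
      (by intro p; split_ifs <;> simp)).offDiagonal_eq hab
    rw [(hτ.apply_zero_zero_eq_zero hab hac (p := (0, 2)) (by decide) (by decide)).1] at e1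
    simp [(hτ.apply_zero_zero_eq_zero hab hac (p := (0, 2)) (by decide) (by decide)).1] at e2
    have f : (c : ℂ) * τ (0, 2) (1, 0) = 0 := by linear_combination (e1 - e2) / 4
    exact (mul_eq_zero.mp f).resolve_left hc'
  have row : ∀ τ, IsSegmentEnd (twoOneDiag a b c) τ → ∀ r : QIdx, r ≠ (0, 0) → r ≠ (0, 1) →
      r ≠ (0, 2) → τ (0, 2) r = 0 := by
    intro τ hτ r h0 h1 h2
    simpa [Equiv.swap_apply_of_ne_of_ne, h2.symm] using
      main _ (hτ.swap (p := (1, 0)) (q := r) (by decide) (by decide) h0 h1)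
  have fix : ∀ r : QIdx, r ≠ p → r ≠ (0, 2) → q ≠ r → Equiv.swap (0, 2) p q ≠ r := by
    intro r h1 h2 h3 h4
    exact h3 (by rw [Equiv.swap_apply_eq_iff] at h4; rw [h4, Equiv.swap_apply_of_ne_of_ne h2 h1])
  have := row _ (h.swap (p := (0, 2)) (q := p) (by decide) (by decide) hp0 hp1)
    (Equiv.swap (0, 2) p q) (fix _ hp0.symm (by decide) hq0) (fix _ hp1.symm (by decide) hq1)
    (by rw [Ne, Equiv.swap_apply_eq_iff, Equiv.swap_apply_left]; exact hpq.symm)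
  simpa using this

theorem IsSegmentEnd.eq_twoOneDiag {a b c : ℝ} {σ : Matrix QIdx QIdx ℂ}
    (hab : (a - c) ^ 2 + (b - c) ^ 2 = 4 * c ^ 2) (hac : a ≠ c) (hbc : b ≠ c) (hc : c ≠ 0)
    (h : IsSegmentEnd (twoOneDiag a b c) σ) :
    σ = twoOneDiag (σ (0, 0) (0, 0)).re (σ (0, 1) (0, 1)).re (σ (0, 2) (0, 2)).re := by
  have hc' : (c : ℂ) ≠ 0 := by exact_mod_cast hc
  have hreal : ∀ p, ((σ p p).re : ℂ) = σ p p := fun p =>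
    Complex.conj_eq_iff_re.mp (h.1.1.1.apply p p)
  have z0 := fun p h0 h1 => h.apply_zero_zero_eq_zero hab hac (p := p) h0 h1
  have z1 := fun p h0 h1 => h.apply_zero_one_eq_zero hab hbc (p := p) h0 h1
  have z := fun p q h0 h1 h2 h3 h4 =>
    h.apply_eq_zero_of_ne hab hac hc (p := p) (q := q) h0 h1 h2 h3 h4
  have hd : ∀ p : QIdx, p ≠ (0, 0) → p ≠ (0, 1) → σ p p = σ (0, 2) (0, 2) := by
    have main : ∀ τ, IsSegmentEnd (twoOneDiag a b c) τ → τ (2, 1) (2, 1) = τ (0, 2) (0, 2) := by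
      intro τ hτ
      have e1 := hτ.diagonal_eq hab
      have e2 := (hτ.swap (p := (0, 2)) (q := (2, 1)) (by decide) (by decide) (by decide)
        (by decide)).diagonal_eq hab
      simp [Equiv.swap_apply_of_ne_of_ne] at e2
      have f : (c : ℂ) * (τ (2, 1) (2, 1) - τ (0, 2) (0, 2)) = 0 := by
        linear_combination (e2 - e1) / 4
      exact sub_eq_zero.mp ((mul_eq_zero.mp f).resolve_left hc')
    intro p h0 h1
    by_cases h2 : p = (0, 2)
    · rw [h2]
    · have := main _ (h.swap (p := (2, 1)) (q := p) (by decide) (by decide) h0 h1)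
      simpa [Equiv.swap_apply_of_ne_of_ne, Ne.symm h2] using this
  have h01 : σ (0, 0) (0, 1) = 0 := by
    have e := h.offDiagonal_eq_of_antisymm hab
    rw [z _ _ (by decide) (by decide) (by decide) (by decide) (by decide),
      z (1, 2) _ (by decide) (by decide) (by decide) (by decide) (by decide),
      z (2, 1) _ (by decide) (by decide) (by decide) (by decide) (by decide),
      (z1 _ (by decide) (by decide)).1, (z0 _ (by decide) (by decide)).2] at e
    exact (mul_eq_zero.mp (show (c : ℂ) * σ (0, 0) (0, 1) = 0 by
      linear_combination -e)).resolve_left hc'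
  have h10 : σ (0, 1) (0, 0) = 0 := by
    rw [← h.1.1.1.apply, h01, star_zero]
  ext p q
  unfold twoOneDiag
  by_cases hpq : p = q
  · subst hpq
    rw [diagonal_apply_eq]
    split_ifs with h0 h1
    · rw [h0, hreal]
    · rw [h1, hreal]
    · rw [hreal, hd p h0 h1]
  · rw [diagonal_apply_ne _ hpq]
    by_cases p0 : p = (0, 0)
    · by_cases q1 : q = (0, 1)
      · rw [p0, q1, h01]
      · rw [p0, (z0 q (fun hq => hpq (p0.trans hq.symm)) q1).2]
    · by_cases p1 : p = (0, 1)
      · by_cases q0 : q = (0, 0)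
        · rw [p1, q0, h10]
        · rw [p1, (z1 q q0 (fun hq => hpq (p1.trans hq.symm))).2]
      · by_cases q0 : q = (0, 0)
        · rw [q0, (z0 p p0 p1).1]
        · by_cases q1 : q = (0, 1)
          · rw [q1, (z1 p p0 p1).1]
          · exact z p q p0 p1 q0 q1 hpq

theorem sq_add_sq_le_of_twoOneDiag_mem_AP33 {a b c : ℝ} (h : twoOneDiag a b c ∈ AP33) :
    (a - c) ^ 2 + (b - c) ^ 2 ≤ 4 * c ^ 2 := by
  have hc : 0 ≤ c := by
    have := h.1.diag_nonneg (i := (0, 2))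
    simpa [twoOneDiag] using this
  set R := √((a - c) ^ 2 + (b - c) ^ 2) with hR
  have hR2 : R ^ 2 = (a - c) ^ 2 + (b - c) ^ 2 := Real.sq_sqrt (by positivity)
  have hR0 : 0 ≤ R := Real.sqrt_nonneg _
  have e := (h.2.2 _ bellUnitary_mem).dotProduct_mulVec_nonneg (schmidtVec ![R, a - c, b - c])
  rw [dotProduct_PT_bellUnitary_conj_twoOneDiag] at e
  have e' := Complex.zero_le_real.mp e
  simp only [Matrix.cons_val] at e'
  rw [← hR2]
  have e2 : 0 ≤ R ^ 2 * (2 * c - R) := by nlinarith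
  rcases hR0.eq_or_lt with h0 | h0
  · rw [← h0]; nlinarith
  · have : 0 ≤ 2 * c - R := nonneg_of_mul_nonneg_right e2 (by positivity)
    nlinarith

theorem twoOneDiag_mem_extremePoints {a b c : ℝ} (hc : 0 < c) (hcb : c < b) (hba : b ≤ a)
    (htr : a + b + 7 * c = 1) (hab : (a - c) ^ 2 + (b - c) ^ 2 = 4 * c ^ 2) :
    twoOneDiag a b c ∈ Set.extremePoints ℝ AP33 := by
  refine ⟨twoOneDiag_mem_AP33 hc.le hcb.le hba htr hab, fun σ hσ τ hτ hmem => ?_⟩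
  have h : IsSegmentEnd (twoOneDiag a b c) σ := ⟨hσ, τ, hτ, hmem⟩
  have hdiag := h.diagonal_eq hab
  have hσeq := h.eq_twoOneDiag hab (hcb.trans_le hba).ne' hcb.ne' hc.ne'
  generalize (σ (0, 0) (0, 0)).re = a', (σ (0, 1) (0, 1)).re = b',
    (σ (0, 2) (0, 2)).re = c' at hσeq
  subst hσeq
  have htr' : a' + b' + 7 * c' = 1 := by
    have := hσ.2.1
    rw [trace_twoOneDiag] at this
    exact_mod_cast this
  have hle := sq_add_sq_le_of_twoOneDiag_mem_AP33 hσ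
  have hlin : 4 * c * c' + (a - c) * (c' - a') + (b - c) * (c' - b') = 0 := by
    simp [twoOneDiag] at hdiag
    exact_mod_cast hdiag
  have hsq : (c * (a' - c') - c' * (a - c)) ^ 2 + (c * (b' - c') - c' * (b - c)) ^ 2 ≤ 0 := by
    have : (c * (a' - c') - c' * (a - c)) ^ 2 + (c * (b' - c') - c' * (b - c)) ^ 2 =
        c ^ 2 * ((a' - c') ^ 2 + (b' - c') ^ 2) - c ^ 2 * (4 * c' ^ 2) := by
      linear_combination c' ^ 2 * hab + 2 * c * c' * hlin
    linarith [mul_le_mul_of_nonneg_left hle (sq_nonneg c)]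
  have ha : c * (a' - c') - c' * (a - c) = 0 := by
    apply pow_eq_zero_iff two_ne_zero |>.mp; nlinarith [sq_nonneg (c * (b' - c') - c' * (b - c)),
      sq_nonneg (c * (a' - c') - c' * (a - c))]
  have hb : c * (b' - c') - c' * (b - c) = 0 := by
    apply pow_eq_zero_iff two_ne_zero |>.mp; nlinarith [sq_nonneg (c * (b' - c') - c' * (b - c)),
      sq_nonneg (c * (a' - c') - c' * (a - c))]
  have hcc : c' = c := by linear_combination c * htr' - c' * htr - ha - hb
  subst hcc
  have ha' : a' = a := mul_left_cancel₀ hc.ne' (by linear_combination ha)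
  have hb' : b' = b := mul_left_cancel₀ hc.ne' (by linear_combination hb)
  rw [ha', hb']

/-- for (9−2√2)/73 < c < 1/11, the state ν₁,₁,₇ = diag(a, b, c, …, c) with
a = (1−7c+√(−73c²+18c−1))/2 and b = (1−7c−√(−73c²+18c−1))/2 is extreme in AP_{3,3}. -/
theorem nu117_extreme (c : ℝ)
    (h1 : (9 - 2 * Real.sqrt 2) / 73 < c) (h2 : c < 1 / 11) :
    diag9 ![(1 - 7 * c + Real.sqrt (-73 * c ^ 2 + 18 * c - 1)) / 2,
        (1 - 7 * c - Real.sqrt (-73 * c ^ 2 + 18 * c - 1)) / 2, c, c, c, c, c, c, c]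
      ∈ Set.extremePoints ℝ AP33 := by
  set D := -73 * c ^ 2 + 18 * c - 1 with hD
  have hs2 : √2 ^ 2 = 2 := Real.sq_sqrt (by norm_num)
  have hs0 : 0 ≤ √2 := Real.sqrt_nonneg _
  have hs1 : √2 < 3 / 2 := by nlinarith
  have hlow : 9 - 2 * √2 < 73 * c := by linarith [(div_lt_iff₀ (by norm_num : (0 : ℝ) < 73)).mp h1]
  have hc : 0 < c := by linarith
  have hD0 : 0 ≤ D := by
    nlinarith [mul_pos (sub_pos.2 hlow) (show 0 < 9 + 2 * √2 - 73 * c by linarith)]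
  have hsD : √D ^ 2 = D := Real.sq_sqrt hD0
  have hsD0 : 0 ≤ √D := Real.sqrt_nonneg _
  have hlt : √D < 1 - 9 * c := by
    apply lt_of_pow_lt_pow_left₀ 2 (by linarith)
    rw [hsD]
    nlinarith [mul_pos (show 0 < 1 - 11 * c by linarith) (show 0 < 1 - 7 * c by linarith)]
  rw [diag9_eq_twoOneDiag]
  refine twoOneDiag_mem_extremePoints hc (by linarith) (by linarith) (by ring) ?_
  linear_combination hsD / 2 + hD / 2
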